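/- Let h = (h_x)_{x ∈ Λ} be i.i.d. standard Gaussians on a finite set Λ, and for A ⊂ Λ let τ_A(h) flip the sign of h on A. Define Δ_A(h) = −(1/β)·log(Z(h)/Z(τ_A(h))) where Z(h) = ∑_{σ ∈ {−1,1}^Λ} exp(−β H(σ, h)) and H(σ, h) = H₀(σ) − ε ∑_{x∈Λ} h_x σ_x for an arbitrary field-independent Hamiltonian H₀. Then for any A, A′ ⊂ Λ and λ > 0, conditionally on h restricted to (A ∪ A′)ᶜ, one has P(|Δ_A(h) − Δ_{A′}(h)| > λ) ≤ 2·exp(−λ²/(8ε²|A Δ A′|)). -/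

import Mathlib

open MeasureTheory ProbabilityTheory

/-- Partition function of a spin system on a finite set `Λ` with field-independent
Hamiltonian `H0` and external field `h` coupled with strength `ε`. -/
noncomputable def partitionZ {Λ : Type*} [Fintype Λ] [DecidableEq Λ] (β ε : ℝ)
    (H0 : (Λ → Bool) → ℝ) (h : Λ → ℝ) : ℝ :=
  ∑ σ : Λ → Bool,
    Real.exp (-β * (H0 σ - ε * ∑ x, h x * (if σ x then 1 else -1)))

/-- The error function `Δ_A(h) = -(1/β) log (Z(h) / Z(τ_A h))`. -/
noncomputable def Δfn {Λ : Type*} [Fintype Λ] [DecidableEq Λ] (β ε : ℝ)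
    (H0 : (Λ → Bool) → ℝ) (A : Finset Λ) (h : Λ → ℝ) : ℝ :=
  -(1 / β) * Real.log (partitionZ β ε H0 h /
      partitionZ β ε H0 (fun x => if x ∈ A then -h x else h x))

open MeasureTheory ProbabilityTheory Filter Topology

/-- one-dimensional subgaussian concentration property -/
def OneDimConc (μ : Measure ℝ) : Prop :=
  ∀ (f : ℝ → ℝ) (c M : ℝ), (∀ x y, |f x - f y| ≤ c * |x - y|) →
    (∀ x, |f x| ≤ M) → ∫ x, Real.exp (f x) ∂μ ≤ Real.exp (∫ x, f x ∂μ + c ^ 2 / 2)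

lemma cont_of_l1 {ι : Type*} [Fintype ι] {f : (ι → ℝ) → ℝ} {c : ℝ}
    (hf : ∀ x y, |f x - f y| ≤ c * ∑ i, |x i - y i|) : Continuous f := by
  rw [continuous_iff_continuousAt]
  intro x
  rw [ContinuousAt, tendsto_iff_dist_tendsto_zero]
  have h2 : Tendsto (fun y : ι → ℝ => c * ∑ i, |y i - x i|) (𝓝 x) (𝓝 0) := by
    have : Continuous (fun y : ι → ℝ => c * ∑ i, |y i - x i|) := by fun_prop
    simpa using this.tendsto x
  exact squeeze_zero (fun _ => dist_nonneg) (fun y => by rw [Real.dist_eq]; exact hf y x) h2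

lemma integrable_bdd {α : Type*} [MeasurableSpace α] {μ : Measure α} [IsFiniteMeasure μ]
    {f : α → ℝ} (hf : Measurable f) {M : ℝ} (hM : ∀ x, |f x| ≤ M) : Integrable f μ :=
  Integrable.of_bound hf.aestronglyMeasurable M (ae_of_all _ hM)

lemma integrable_exp_bdd {α : Type*} [MeasurableSpace α] {μ : Measure α} [IsFiniteMeasure μ]
    {f : α → ℝ} (hf : Measurable f) {M : ℝ} (hM : ∀ x, |f x| ≤ M) :
    Integrable (fun x => Real.exp (f x)) μ :=
  integrable_bdd (hf.exp) (M := Real.exp M) fun x => by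
    rw [abs_of_pos (Real.exp_pos _)]
    exact Real.exp_le_exp.2 ((le_abs_self _).trans (hM x))

lemma tensor (μ : Measure ℝ) [IsProbabilityMeasure μ] (hμ : OneDimConc μ) (n : ℕ) :
    ∀ (f : (Fin n → ℝ) → ℝ) (c M : ℝ), (∀ x y, |f x - f y| ≤ c * ∑ i, |x i - y i|) →
    (∀ x, |f x| ≤ M) → ∫ x, Real.exp (f x) ∂(Measure.pi fun _ => μ) ≤
      Real.exp (∫ x, f x ∂(Measure.pi fun _ => μ) + n * c ^ 2 / 2) := by
  induction n with
  | zero =>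
    intro f c M hf hM
    rw [Measure.pi_of_empty]
    simp
  | succ n ih =>
    intro f c M hf hM
    have hfc := cont_of_l1 hf
    have key : ∀ g : (Fin (n+1) → ℝ) → ℝ, ∫ x, g x ∂(Measure.pi fun _ => μ) =
        ∫ p, g (Fin.cons p.1 p.2) ∂(μ.prod (Measure.pi fun _ : Fin n => μ)) := by
      intro g
      rw [← ((measurePreserving_piFinSuccAbove (fun _ : Fin (n+1) => μ) 0).symm).integral_comp']
      simp_rw [MeasurableEquiv.piFinSuccAbove_symm_apply, Fin.insertNthEquiv,
        Equiv.coe_fn_mk, Fin.insertNth_zero]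
      rfl
    have hcons : Continuous (fun p : ℝ × (Fin n → ℝ) => (Fin.cons p.1 p.2 : Fin (n+1) → ℝ)) := by
      refine continuous_pi fun i => ?_
      refine Fin.cases ?_ (fun j => ?_) i
      · simpa using continuous_fst
      · simp only [Fin.cons_succ]; fun_prop
    have hF : Continuous (fun p : ℝ × (Fin n → ℝ) => f (Fin.cons p.1 p.2)) := hfc.comp hcons
    have hFx : ∀ x : ℝ, Continuous (fun y : Fin n → ℝ => f (Fin.cons x y)) := fun x =>
      hF.comp (by fun_prop : Continuous fun y : Fin n → ℝ => (x, y))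
    have i1 : ∀ x, Integrable (fun y : Fin n → ℝ => f (Fin.cons x y)) (Measure.pi fun _ => μ) :=
      fun x => integrable_bdd (hFx x).measurable (fun y => hM _)
    set g : ℝ → ℝ := fun x => ∫ y, f (Fin.cons x y) ∂(Measure.pi fun _ : Fin n => μ) with hg
    have hgL : ∀ x y, |g x - g y| ≤ c * |x - y| := by
      intro x y
      simp only [hg]
      rw [← integral_sub (i1 x) (i1 y)]
      have := norm_integral_le_of_norm_le_const (μ := Measure.pi fun _ : Fin n => μ)
        (f := fun z => f (Fin.cons x z) - f (Fin.cons y z)) (C := c * |x - y|)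
        (ae_of_all _ fun z => by
          rw [Real.norm_eq_abs]
          refine (hf _ _).trans (le_of_eq ?_)
          simp [Fin.sum_univ_succ])
      simpa using this
    have hgM : ∀ x, |g x| ≤ M := by
      intro x
      have := norm_integral_le_of_norm_le_const (μ := Measure.pi fun _ : Fin n => μ)
        (f := fun z => f (Fin.cons x z)) (C := M) (ae_of_all _ fun z => hM _)
      simpa using this
    have hgc : Measurable g := by
      have : LipschitzWith (Real.toNNReal c) g := LipschitzWith.of_dist_le_mul fun x y => by
        rw [Real.dist_eq, Real.dist_eq]
        exact (hgL x y).trans (mul_le_mul_of_nonneg_right (Real.le_coe_toNNReal c) (abs_nonneg _))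
      exact this.continuous.measurable
    rw [key, key, integral_prod _ (integrable_exp_bdd hF.measurable (fun p => hM _)),
      integral_prod _ (integrable_bdd hF.measurable (fun p => hM _))]
    calc ∫ x, ∫ y, Real.exp (f (Fin.cons x y)) ∂(Measure.pi fun _ : Fin n => μ) ∂μ
        ≤ ∫ x, Real.exp (g x) * Real.exp (n * c ^ 2 / 2) ∂μ := by
          refine integral_mono (integrable_exp_bdd hF.measurable (fun p => hM _)).integral_prod_left
            ((integrable_exp_bdd hgc hgM).mul_const _) fun x => ?_
          simp only []
          rw [← Real.exp_add]
          refine ih (fun y => f (Fin.cons x y)) c M (fun y z => ?_) (fun y => hM _)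
          refine (hf _ _).trans (le_of_eq ?_)
          simp [Fin.sum_univ_succ]
      _ = (∫ x, Real.exp (g x) ∂μ) * Real.exp (n * c ^ 2 / 2) := integral_mul_const _ _
      _ ≤ Real.exp (∫ x, g x ∂μ + c ^ 2 / 2) * Real.exp (n * c ^ 2 / 2) := by
          gcongr
          exact hμ g c M hgL hgM
      _ = _ := by
          rw [← Real.exp_add]; congr 1; push_cast; ring

noncomputable def rad : Measure ℝ :=
  (2⁻¹ : ENNReal) • Measure.dirac 1 + (2⁻¹ : ENNReal) • Measure.dirac (-1)

instance : IsProbabilityMeasure rad := ⟨by simp [rad, ENNReal.inv_two_add_inv_two]⟩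

lemma integral_rad (f : ℝ → ℝ) : ∫ x, f x ∂rad = (f 1 + f (-1)) / 2 := by
  rw [rad, integral_add_measure, integral_smul_measure, integral_smul_measure]
  · simp; ring
  · exact (integrable_dirac (by simp)).smul_measure (by simp)
  · exact (integrable_dirac (by simp)).smul_measure (by simp)

lemma rad_conc : OneDimConc rad := by
  intro f c M hf hM
  rw [integral_rad, integral_rad]
  have h := hf 1 (-1)
  norm_num at h
  set a := (f 1 + f (-1)) / 2 with ha
  set b := (f 1 - f (-1)) / 2 with hb
  have e1 : f 1 = a + b := by ring
  have e2 : f (-1) = a - b := by ring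
  have e3 : (Real.exp (f 1) + Real.exp (f (-1))) / 2 = Real.exp a * Real.cosh b := by
    rw [e1, e2, Real.cosh_eq, Real.exp_add, sub_eq_add_neg, Real.exp_add]; ring
  rw [e3, Real.exp_add]
  refine mul_le_mul_of_nonneg_left ((Real.cosh_le_exp_half_sq b).trans ?_) (Real.exp_pos _).le
  rw [Real.exp_le_exp]
  have : b ^ 2 ≤ c ^ 2 := by
    rw [sq_le_sq]
    have : |b| ≤ c := by rw [hb, abs_div]; norm_num; linarith
    exact this.trans (le_abs_self c)
  linarith

lemma gauss_conc : OneDimConc (gaussianReal 0 1) := by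
  intro f c M hf hM
  obtain ⟨Ω, mΩ, P, X, hXm, hlaw, hind, hP⟩ := exists_iid ℕ rad
  have hfc : Continuous f := by
    have : LipschitzWith (Real.toNNReal c) f := LipschitzWith.of_dist_le_mul fun x y => by
      rw [Real.dist_eq, Real.dist_eq]
      exact (hf x y).trans (mul_le_mul_of_nonneg_right (Real.le_coe_toNNReal c) (abs_nonneg _))
    exact this.continuous
  have hclt := tendstoInDistribution_inv_sqrt_mul_sum (P := P) (X := X)
    (Y := id) (P' := gaussianReal 0 1) HasLaw.id
    (by
      have h := (hlaw 0).integral_comp (f := fun x : ℝ => x) (by fun_prop)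
      rw [integral_rad] at h
      simpa using h)
    (by
      have h := (hlaw 0).integral_comp (f := fun x : ℝ => x ^ 2) (by fun_prop)
      rw [integral_rad] at h
      simpa [Function.comp_def] using h)
    hind (fun i => ⟨(hXm i).aemeasurable, (hXm 0).aemeasurable,
      (hlaw i).map_eq.trans (hlaw 0).map_eq.symm⟩)
  have ht := ProbabilityMeasure.tendsto_iff_forall_integral_tendsto.1 hclt.tendsto
  have hSm : ∀ n : ℕ, Measurable (fun ω => (√(n:ℝ))⁻¹ * ∑ k ∈ Finset.range n, X k ω) := by
    intro n; fun_prop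
  have ht' : ∀ g : ℝ → ℝ, Continuous g → (∃ K, ∀ x, |g x| ≤ K) → Tendsto (fun n : ℕ =>
      ∫ ω, g ((√(n:ℝ))⁻¹ * ∑ k ∈ Finset.range n, X k ω) ∂P) atTop
      (𝓝 (∫ x, g x ∂(gaussianReal 0 1))) := by
    rintro g hg ⟨K, hK⟩
    have h := ht (BoundedContinuousFunction.ofNormedAddCommGroup g hg K hK)
    simp only [ProbabilityMeasure.coe_mk, BoundedContinuousFunction.coe_ofNormedAddCommGroup,
      Measure.map_id] at h
    refine h.congr fun n => ?_
    rw [integral_map (hSm n).aemeasurable hg.aestronglyMeasurable]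
  have hbe : ∀ x, |Real.exp (f x)| ≤ Real.exp M := fun x => by
    rw [abs_of_pos (Real.exp_pos _)]
    exact Real.exp_le_exp.2 ((le_abs_self _).trans (hM x))
  have T1 := ht' (fun x => Real.exp (f x)) (by fun_prop) ⟨_, hbe⟩
  have T2 := ht' f hfc ⟨M, hM⟩
  have T3 := (Real.continuous_exp.tendsto _).comp (T2.add_const (c ^ 2 / 2))
  refine le_of_tendsto_of_tendsto T1 T3 ?_
  filter_upwards [eventually_gt_atTop 0] with n hn
  have hn' : (0:ℝ) < n := by exact_mod_cast hn
  have hpi : P.map (fun ω (i : Fin n) => X i ω) = Measure.pi fun _ : Fin n => rad := by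
    rw [(iIndepFun_iff_map_fun_eq_pi_map (fun i => (hXm _).aemeasurable)).1
      (hind.precomp (g := fun i : Fin n => (i : ℕ)) Fin.val_injective)]
    congr 1; funext i; exact (hlaw i).map_eq
  have hmap : ∀ g : ℝ → ℝ, Continuous g →
      ∫ ω, g ((√(n:ℝ))⁻¹ * ∑ k ∈ Finset.range n, X k ω) ∂P =
      ∫ x : Fin n → ℝ, g ((√(n:ℝ))⁻¹ * ∑ k, x k) ∂(Measure.pi fun _ : Fin n => rad) := by
    intro g hg
    rw [← hpi, integral_map (by fun_prop)
      (by exact (by fun_prop : Continuous fun x : Fin n → ℝ =>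
        g ((√(n:ℝ))⁻¹ * ∑ k, x k)).aestronglyMeasurable)]
    simp_rw [Finset.sum_range]
  simp only [Function.comp]
  rw [hmap _ (by fun_prop : Continuous fun x => Real.exp (f x)), hmap _ hfc]
  have hs : (0:ℝ) < √(n:ℝ) := Real.sqrt_pos.2 hn'
  have hc : 0 ≤ c := by
    have := (abs_nonneg _).trans (hf 1 0)
    simpa using this
  have := tensor rad rad_conc n (fun x => f ((√(n:ℝ))⁻¹ * ∑ k, x k)) (c * (√(n:ℝ))⁻¹) M
    (fun x y => by
      refine (hf _ _).trans ?_
      rw [← mul_sub, ← Finset.sum_sub_distrib, abs_mul, abs_of_pos (inv_pos.2 hs), mul_assoc]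
      gcongr
      exact Finset.abs_sum_le_sum_abs _ _) (fun x => hM _)
  refine this.trans (le_of_eq ?_)
  congr 2
  rw [mul_pow, inv_pow, Real.sq_sqrt hn'.le]
  field_simp

lemma tail_fin (n : ℕ) (f : (Fin n → ℝ) → ℝ) (c lamb : ℝ) (hc : 0 < c) (hl : 0 < lamb)
    (hf : ∀ x y, |f x - f y| ≤ c * ∑ i, |x i - y i|) (hodd : ∀ x, f (fun i => - x i) = - f x) :
    (Measure.pi fun _ : Fin n => gaussianReal 0 1) {x | lamb < |f x|} ≤
      ENNReal.ofReal (2 * Real.exp (-lamb ^ 2 / (2 * (n * c ^ 2)))) := by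
  set μ := (Measure.pi fun _ : Fin n => gaussianReal 0 1) with hμ
  set F : (Fin n → ℝ) → ℝ := fun x => max (-(2 * lamb)) (min (2 * lamb) (f x)) with hF
  have hFM : ∀ x, |F x| ≤ 2 * lamb := fun x => by
    rw [abs_le]
    exact ⟨le_max_left _ _, max_le (by linarith) (min_le_left _ _)⟩
  have hFL : ∀ x y, |F x - F y| ≤ c * ∑ i, |x i - y i| := fun x y => by
    refine le_trans ?_ (hf x y)
    refine (abs_max_sub_max_le_max _ _ _ _).trans ?_
    simp only [sub_self, abs_zero]
    refine max_le (abs_nonneg _) ?_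
    refine (abs_min_sub_min_le_max _ _ _ _).trans ?_
    simp
  have hFodd : ∀ x, F (fun i => - x i) = - F x := fun x => by
    simp only [hF, hodd]
    grind
  have hFc : Measurable F := (cont_of_l1 hFL).measurable
  have hmean : ∫ x, F x ∂μ = 0 := by
    have hmp : MeasurePreserving (fun (x : Fin n → ℝ) i => - x i) μ μ :=
      measurePreserving_pi (fun _ => gaussianReal 0 1) (fun _ => gaussianReal 0 1)
        (f := fun _ x => -x)
        (fun _ => ⟨measurable_neg, by rw [gaussianReal_map_neg, neg_zero]⟩)
    have h1 : ∫ x, F (fun i => - x i) ∂μ = ∫ x, F x ∂μ := by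
      have := integral_map (μ := μ) hmp.aemeasurable (f := F) hFc.aestronglyMeasurable
      rw [hmp.map_eq] at this
      exact this.symm
    simp_rw [hFodd] at h1
    rw [integral_neg] at h1
    linarith
  have hmgf : ∀ t, mgf F μ t ≤ Real.exp ((n * c ^ 2) * t ^ 2 / 2) := by
    intro t
    have := tensor _ gauss_conc n (fun x => t * F x) (|t| * c) (|t| * (2 * lamb))
      (fun x y => by
        rw [← mul_sub, abs_mul, mul_assoc]
        exact mul_le_mul_of_nonneg_left (hFL x y) (abs_nonneg _))
      (fun x => by
        rw [abs_mul]
        exact mul_le_mul_of_nonneg_left (hFM x) (abs_nonneg _))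
    rw [integral_const_mul, ← hμ, hmean] at this
    refine this.trans (le_of_eq ?_)
    rw [mul_pow, sq_abs]; congr 1; ring
  have hint : ∀ t, Integrable (fun x => Real.exp (t * F x)) μ := fun t =>
    integrable_exp_bdd (hFc.const_mul t) (M := |t| * (2 * lamb)) (fun x => by
        rw [abs_mul]
        exact mul_le_mul_of_nonneg_left (hFM x) (abs_nonneg _))
  have hsub : HasSubgaussianMGF F ⟨n * c ^ 2, by positivity⟩ μ := ⟨hint, hmgf⟩
  have b1 := hsub.measure_ge_le hl.le
  have b2 := hsub.neg.measure_ge_le hl.le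
  have hset : {x | lamb < |f x|} ⊆ {x | lamb ≤ F x} ∪ {x | lamb ≤ (-F) x} := by
    intro x hx
    simp only [Set.mem_ofPred_eq, lt_abs] at hx
    rcases hx with h | h
    · left
      exact le_max_of_le_right (le_min (by linarith) h.le)
    · right
      simp only [Set.mem_ofPred_eq, Pi.neg_apply, hF]
      rw [le_neg]
      exact max_le (by linarith) (min_le_of_right_le (by linarith))
  calc μ {x | lamb < |f x|} ≤ μ ({x | lamb ≤ F x} ∪ {x | lamb ≤ (-F) x}) := measure_mono hset
    _ = ENNReal.ofReal (μ.real ({x | lamb ≤ F x} ∪ {x | lamb ≤ (-F) x})) := by simp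
    _ ≤ _ := by
      apply ENNReal.ofReal_le_ofReal
      refine (measureReal_union_le _ _).trans ?_
      have := add_le_add b1 b2
      refine this.trans (le_of_eq ?_)
      exact (two_mul _).symm

lemma tail_fintype {ι : Type*} [Fintype ι] (f : (ι → ℝ) → ℝ) (c lamb : ℝ) (hc : 0 < c)
    (hl : 0 < lamb)
    (hf : ∀ x y, |f x - f y| ≤ c * ∑ i, |x i - y i|) (hodd : ∀ x, f (fun i => - x i) = - f x) :
    (Measure.pi fun _ : ι => gaussianReal 0 1) {x | lamb < |f x|} ≤
      ENNReal.ofReal (2 * Real.exp (-lamb ^ 2 / (2 * (Fintype.card ι * c ^ 2)))) := by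
  set e := (Fintype.equivFin ι).symm
  have hmp := measurePreserving_piCongrLeft (fun _ : ι => gaussianReal 0 1) e
  rw [← hmp.measure_preimage_equiv]
  have happ : ∀ (x : Fin (Fintype.card ι) → ℝ) i,
      MeasurableEquiv.piCongrLeft (fun _ : ι => ℝ) e x i = x (e.symm i) := by
    intro x i
    obtain ⟨j, rfl⟩ := e.surjective i
    simp [MeasurableEquiv.piCongrLeft]
  refine tail_fin _ (fun x => f (MeasurableEquiv.piCongrLeft (fun _ : ι => ℝ) e x)) c lamb hc hl
    (fun x y => ?_) (fun x => ?_)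
  · refine (hf _ _).trans (le_of_eq ?_)
    simp_rw [happ]
    congr 1
    exact Equiv.sum_comp e.symm (fun i => |x i - y i|)
  · rw [← hodd]
    congr 1
    funext i
    simp only [happ]

lemma partitionZ_pos' {Λ : Type*} [Fintype Λ] [DecidableEq Λ] (β ε : ℝ)
    (H0 : (Λ → Bool) → ℝ) (h : Λ → ℝ) : 0 < partitionZ β ε H0 h :=
  Finset.sum_pos (fun _ _ => Real.exp_pos _) Finset.univ_nonempty

lemma log_partitionZ_le {Λ : Type*} [Fintype Λ] [DecidableEq Λ] (β ε : ℝ)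
    (hβ : 0 < β) (hε : 0 < ε) (H0 : (Λ → Bool) → ℝ) (h k : Λ → ℝ) :
    Real.log (partitionZ β ε H0 h) ≤
      Real.log (partitionZ β ε H0 k) + β * ε * ∑ x, |h x - k x| := by
  rw [Real.log_le_iff_le_exp (partitionZ_pos' ..), Real.exp_add,
    Real.exp_log (partitionZ_pos' ..)]
  unfold partitionZ
  rw [Finset.sum_mul]
  refine Finset.sum_le_sum fun σ _ => ?_
  rw [← Real.exp_add, Real.exp_le_exp]
  have h1 : ∑ x, h x * (if σ x then (1:ℝ) else -1) ≤
      ∑ x, k x * (if σ x then (1:ℝ) else -1) + ∑ x, |h x - k x| := by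
    rw [← Finset.sum_add_distrib]
    refine Finset.sum_le_sum fun x _ => ?_
    have := le_abs_self (h x - k x)
    have := neg_abs_le (h x - k x)
    split_ifs <;> linarith
  have h2 := mul_le_mul_of_nonneg_left h1 (mul_pos hβ hε).le
  nlinarith [h2]

lemma log_partitionZ_lip {Λ : Type*} [Fintype Λ] [DecidableEq Λ] (β ε : ℝ)
    (hβ : 0 < β) (hε : 0 < ε) (H0 : (Λ → Bool) → ℝ) (h k : Λ → ℝ) :
    |Real.log (partitionZ β ε H0 h) - Real.log (partitionZ β ε H0 k)| ≤
      β * ε * ∑ x, |h x - k x| := by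
  have h1 := log_partitionZ_le β ε hβ hε H0 h k
  have h2 := log_partitionZ_le β ε hβ hε H0 k h
  simp_rw [fun x => abs_sub_comm (k x) (h x)] at h2
  rw [abs_le]
  constructor <;> linarith

lemma Δfn_sub {Λ : Type*} [Fintype Λ] [DecidableEq Λ] (β ε : ℝ)
    (H0 : (Λ → Bool) → ℝ) (A A' : Finset Λ) (h : Λ → ℝ) :
    Δfn β ε H0 A h - Δfn β ε H0 A' h =
      (1 / β) * (Real.log (partitionZ β ε H0 (fun x => if x ∈ A then -h x else h x)) -
        Real.log (partitionZ β ε H0 (fun x => if x ∈ A' then -h x else h x))) := by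
  unfold Δfn
  rw [Real.log_div (partitionZ_pos' ..).ne' (partitionZ_pos' ..).ne',
    Real.log_div (partitionZ_pos' ..).ne' (partitionZ_pos' ..).ne']
  ring

theorem stmt17 {Λ : Type*} [Fintype Λ] [DecidableEq Λ] (β ε lamb : ℝ)
    (hβ : 0 < β) (hε : 0 < ε) (hlamb : 0 < lamb)
    (H0 : (Λ → Bool) → ℝ) (A A' : Finset Λ) (u : Λ → ℝ) :
    (Measure.pi fun _ : Λ => gaussianReal 0 1)
      {h : Λ → ℝ |
        lamb < |Δfn β ε H0 A (fun x => if x ∈ A ∪ A' then h x else u x) -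
                Δfn β ε H0 A' (fun x => if x ∈ A ∪ A' then h x else u x)|} ≤
      ENNReal.ofReal
        (2 * Real.exp (-lamb ^ 2 / (8 * ε ^ 2 * ((symmDiff A A').card : ℝ)))) := by
  set G : (Λ → ℝ) → ℝ := fun h =>
    Δfn β ε H0 A (fun x => if x ∈ A ∪ A' then h x else u x) -
      Δfn β ε H0 A' (fun x => if x ∈ A ∪ A' then h x else u x) with hG
  have hGL : ∀ h k, |G h - G k| ≤ (2 * ε) * ∑ x, |h x - k x| := by
    intro h k
    simp only [hG, Δfn_sub]
    have step : ∀ B : Finset Λ,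
        |Real.log (partitionZ β ε H0 (fun x => if x ∈ B then
            -(if x ∈ A ∪ A' then h x else u x) else (if x ∈ A ∪ A' then h x else u x))) -
          Real.log (partitionZ β ε H0 (fun x => if x ∈ B then
            -(if x ∈ A ∪ A' then k x else u x) else (if x ∈ A ∪ A' then k x else u x)))| ≤
          β * ε * ∑ x, |h x - k x| := by
      intro B
      refine (log_partitionZ_lip β ε hβ hε H0 _ _).trans ?_
      refine mul_le_mul_of_nonneg_left (Finset.sum_le_sum fun x _ => ?_) (mul_pos hβ hε).le
      have := abs_nonneg (h x - k x)
      have e : |-h x - -k x| = |h x - k x| := by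
        rw [← abs_neg]; congr 1; ring
      split_ifs <;> first | exact e.le | exact le_rfl | simp
    have s1 := step A
    have s2 := step A'
    rw [← mul_sub, abs_mul, abs_of_pos (by positivity : 0 < 1 / β), one_div,
      inv_mul_le_iff₀ hβ]
    rw [abs_le] at s1 s2 ⊢
    constructor <;> nlinarith [s1.1, s1.2, s2.1, s2.2]
  have hGm : Measurable G := (cont_of_l1 hGL).measurable
  have hE : MeasurableSet {h | lamb < |G h|} := measurableSet_lt measurable_const hGm.abs
  obtain ⟨p, hp⟩ : ∃ p : Λ → Prop, ∀ x, p x ↔ x ∈ symmDiff A A' := ⟨_, fun _ => Iff.rfl⟩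
  classical
  have hmp := (measurePreserving_piEquivPiSubtypeProd (fun _ : Λ => gaussianReal 0 1) p).symm
  change (Measure.pi fun _ : Λ => gaussianReal 0 1) {h | lamb < |G h|} ≤ _
  rw [← hmp.measure_preimage_equiv, Measure.prod_apply_symm (hmp.measurable hE)]
  set J : (Subtype p → ℝ) → ({x // ¬ p x} → ℝ) → Λ → ℝ := fun w v =>
    (MeasurableEquiv.piEquivPiSubtypeProd (fun _ : Λ => ℝ) p).symm (w, v) with hJ
  have hJ1 : ∀ w v (x : Subtype p), J w v x = w x := fun w v x => by
    simp [hJ, MeasurableEquiv.piEquivPiSubtypeProd, Equiv.piEquivPiSubtypeProd, x.2]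
  have hJ2 : ∀ w v (x : {x // ¬ p x}), J w v x = v x := fun w v x => by
    simp [hJ, MeasurableEquiv.piEquivPiSubtypeProd, Equiv.piEquivPiSubtypeProd, x.2]
  have hcard : Fintype.card (Subtype p) = (symmDiff A A').card := by
    simp only [Fintype.card_subtype, hp]
    simp
  have hsec : ∀ v : {x // ¬ p x} → ℝ,
      (Measure.pi fun _ : Subtype p => gaussianReal 0 1) {w | lamb < |G (J w v)|} ≤
      ENNReal.ofReal
        (2 * Real.exp (-lamb ^ 2 / (8 * ε ^ 2 * ((symmDiff A A').card : ℝ)))) := by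
    intro v
    refine (tail_fintype (fun w => G (J w v)) (2 * ε) lamb (by positivity) hlamb
      (fun w w' => ?_) (fun w => ?_)).trans (le_of_eq ?_)
    · refine (hGL _ _).trans (le_of_eq ?_)
      rw [← Fintype.sum_subtype_add_sum_subtype p]
      simp [hJ1, hJ2]
    · simp only [hG, Δfn_sub]
      rw [← mul_neg, neg_sub]
      have hx : ∀ x, (x ∈ symmDiff A A' ∧ J (fun i => - w i) v x = - J w v x) ∨
          (x ∉ symmDiff A A' ∧ J (fun i => - w i) v x = J w v x) := by
        intro x
        by_cases h : p x
        · left; exact ⟨by rwa [← hp], by rw [hJ1 _ v ⟨x, h⟩, hJ1 _ v ⟨x, h⟩]⟩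
        · right; exact ⟨by rwa [← hp], by rw [hJ2 _ v ⟨x, h⟩, hJ2 _ v ⟨x, h⟩]⟩
      congr 4 <;>
      · funext x
        rcases hx x with ⟨h, e⟩ | ⟨h, e⟩ <;> rw [e] <;> rw [Finset.mem_symmDiff] at h <;>
          by_cases ha : x ∈ A <;> by_cases ha' : x ∈ A' <;> simp_all
    · rw [hcard]; congr 4; ring
  refine (lintegral_mono hsec).trans ?_
  simp
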